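/- Let M ≥ 1 be an integer, let Υ_ν, Υ_e, Υ_u, Υ_d be M×M complex matrices, let a_u := tr(Υ_ν†Υ_ν) + 3·tr(Υ_u†Υ_u) and a_d := tr(Υ_e†Υ_e) + 3·tr(Υ_d†Υ_d), and assume a_u > 0 and a_d > 0. Let ω_12 ≠ 0 and ω_23 be real numbers such that 1_M = (1/a_u)·Υ_νᵗ(Υ_ν*)ᵗ + (1/a_d)·Υ_eᵗ(Υ_e*)ᵗ and (ω_23/ω_12)·1_M = (1/a_u)·Υ_u†Υ_u + (1/a_d)·Υ_d†Υ_d, where 1_M is the M×M identity matrix, ᵗ denotes transpose and * entrywise complex conjugation. Then (2 − M)·ω_12 = 3M·ω_23. -/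

import Mathlib

open Matrix

lemma aux_tr {M : ℕ} (A : Matrix (Fin M) (Fin M) ℂ) :
    ((Aᴴ * A).trace).re = ∑ i, ∑ j, ((A i j).re ^ 2 + (A i j).im ^ 2) := by
  rw [Finset.sum_comm]
  simp only [Matrix.trace, Matrix.diag, Matrix.mul_apply, Matrix.conjTranspose_apply,
    Complex.re_sum]
  refine Finset.sum_congr rfl fun i _ => Finset.sum_congr rfl fun j _ => ?_
  simp [Complex.mul_re]
  ring

lemma aux_nonneg {M : ℕ} (A : Matrix (Fin M) (Fin M) ℂ) : 0 ≤ ((Aᴴ * A).trace).re := by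
  rw [aux_tr]
  positivity

lemma aux_tr2 {M : ℕ} (A : Matrix (Fin M) (Fin M) ℂ) :
    ((Aᵀ * (A.map (starRingEnd ℂ))ᵀ).trace).re =
      ∑ i, ∑ j, ((A i j).re * (A j i).re + (A i j).im * (A j i).im) := by
  simp only [Matrix.trace, Matrix.diag, Matrix.mul_apply, Matrix.transpose_apply,
    Matrix.map_apply, Complex.re_sum]
  refine Finset.sum_congr rfl fun i _ => Finset.sum_congr rfl fun j _ => ?_
  simp [Complex.mul_re]
  ring

lemma aux_le {M : ℕ} (A : Matrix (Fin M) (Fin M) ℂ) :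
    ((Aᵀ * (A.map (starRingEnd ℂ))ᵀ).trace).re ≤ ((Aᴴ * A).trace).re := by
  have h1 := aux_tr A
  have h2 := aux_tr A
  rw [Finset.sum_comm] at h2
  have h3 : 2 * ((Aᵀ * (A.map (starRingEnd ℂ))ᵀ).trace).re ≤
      ((Aᴴ * A).trace).re + ((Aᴴ * A).trace).re := by
    nth_rewrite 1 [h1]
    rw [h2, aux_tr2]
    simp only [← Finset.sum_add_distrib, Finset.mul_sum]
    refine Finset.sum_le_sum fun i _ => Finset.sum_le_sum fun j _ => ?_
    nlinarith [sq_nonneg ((A i j).re - (A j i).re), sq_nonneg ((A i j).im - (A j i).im)]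
  linarith

lemma aux_one (A : Matrix (Fin 1) (Fin 1) ℂ) :
    ((Aᵀ * (A.map (starRingEnd ℂ))ᵀ).trace).re = ((Aᴴ * A).trace).re := by
  rw [aux_tr, aux_tr2]
  simp [sq]

/-- For `M×M` complex Yukawa matrices `Υν`, `Υe`, `Υu`, `Υd` with
`a_u = tr(Υν† Υν) + 3 tr(Υu† Υu) > 0` and `a_d = tr(Υe† Υe) + 3 tr(Υd† Υd) > 0`,
if `ω₁₂ ≠ 0` and `ω₂₃` are reals such that
`1 = (1/a_u) Υνᵗ (Υν*)ᵗ + (1/a_d) Υeᵗ (Υe*)ᵗ` and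
`(ω₂₃/ω₁₂) 1 = (1/a_u) Υu† Υu + (1/a_d) Υd† Υd`, then `(2 − M) ω₁₂ = 3 M ω₂₃`. -/
theorem stmt_7 (M : ℕ) (hM : 1 ≤ M)
    (Υν Υe Υu Υd : Matrix (Fin M) (Fin M) ℂ)
    (a_u a_d : ℝ)
    (ha_u : (a_u : ℂ) = (Υνᴴ * Υν).trace + 3 * (Υuᴴ * Υu).trace)
    (ha_d : (a_d : ℂ) = (Υeᴴ * Υe).trace + 3 * (Υdᴴ * Υd).trace)
    (ha_u_pos : 0 < a_u) (ha_d_pos : 0 < a_d)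
    (ω12 ω23 : ℝ) (hω12 : ω12 ≠ 0)
    (h1 : (1 : Matrix (Fin M) (Fin M) ℂ) =
      (1 / (a_u : ℂ)) • (Υνᵀ * (Υν.map (starRingEnd ℂ))ᵀ) +
      (1 / (a_d : ℂ)) • (Υeᵀ * (Υe.map (starRingEnd ℂ))ᵀ))
    (h2 : ((ω23 / ω12 : ℝ) : ℂ) • (1 : Matrix (Fin M) (Fin M) ℂ) =
      (1 / (a_u : ℂ)) • (Υuᴴ * Υu) + (1 / (a_d : ℂ)) • (Υdᴴ * Υd)) :
    (2 - (M : ℝ)) * ω12 = 3 * (M : ℝ) * ω23 := by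
  have e1 := congrArg (fun X => (Matrix.trace X).re) h1
  have e2 := congrArg (fun X => (Matrix.trace X).re) h2
  have e3 := congrArg Complex.re ha_u
  have e4 := congrArg Complex.re ha_d
  have key : ∀ (a : ℝ) (z : ℂ), ((1 / (a : ℂ)) * z).re = z.re / a := by
    intro a z
    rw [one_div, ← Complex.ofReal_inv, Complex.re_ofReal_mul]
    ring
  simp only [Matrix.trace_add, Matrix.trace_smul, Matrix.trace_one, smul_eq_mul,
    Complex.add_re, key, Fintype.card_fin, Complex.natCast_re, Complex.re_ofReal_mul,
    Complex.ofReal_re] at e1 e2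
  have h3 : ∀ z : ℂ, (3 * z).re = 3 * z.re := by intro z; simp
  simp only [Complex.add_re, h3, Complex.ofReal_re] at e3 e4
  have lν := div_le_div_of_nonneg_right (aux_le Υν) ha_u_pos.le
  have le := div_le_div_of_nonneg_right (aux_le Υe) ha_d_pos.le
  have pu := div_nonneg (aux_nonneg Υu) ha_u_pos.le
  have pd := div_nonneg (aux_nonneg Υd) ha_d_pos.le
  have e5 : (Υνᴴ * Υν).trace.re / a_u + 3 * ((Υuᴴ * Υu).trace.re / a_u) = 1 := by
    field_simp
    linarith
  have e6 : (Υeᴴ * Υe).trace.re / a_d + 3 * ((Υdᴴ * Υd).trace.re / a_d) = 1 := by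
    field_simp
    linarith
  have main : (2 - (M : ℝ)) = 3 * ((ω23 / ω12) * M) := by
    rcases Nat.lt_or_ge 1 M with h | h
    · have hM2 : (2 : ℝ) ≤ M := by exact_mod_cast h
      linarith
    · obtain rfl : M = 1 := le_antisymm h hM
      rw [aux_one, aux_one] at e1
      linarith
  rw [main]
  field_simp
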